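/- Let ω ⊂ ℝ² be open, bounded and connected with smooth boundary and sup_{t∈ω}|t| ≤ d, and let E₁ := inf{ ∫_ω|∇v|²dt / ∫_ω|v|²dt : v ∈ C_c^∞(ω), v ≠ 0 } be the bottom of the Dirichlet Laplacian on ω. Let θ ∈ C_c¹(ℝ) have a bounded second derivative, set θ_m = inf supp θ' and θ_M = sup supp θ', let a ≥ θ_M and l > 0, and let p ∈ (θ_m, θ_M) and r > 0 be such that θ'(s) ≠ 0 for all s ∈ [p−r, p]. Assume: (i) there exists λ > 0 with ∫_ω|∂_τ v|²dt + ∫_ω|∇v|²dt − E₁∫_ω|v|²dt ≥ λ∫_ω|v|²dt for all v ∈ C_c^∞(ω); (ii) there exists λ₀ > 0 such that Q^{(p−r,p)}(ψ) ≥ λ₀ ∫_{(p−r,p)×ω}|ψ|² ds dt for every admissible ψ. Then there exists C > 0 such that for every admissible ψ, ∫_{(−∞,p)×ω} ( |∇'ψ|² + |∂_sψ + θ' ∂_τψ|² − E₁|ψ|² ) ds dt ≥ C ∫_{(−∞,p)×ω} ρ(s)|ψ|² ds dt. -/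

import Mathlib

open MeasureTheory Real Set

/-- The Hardy weight `ρ` centred at `p`. -/
noncomputable def rho (p : ℝ) (s : ℝ) : ℝ := if s ≤ p then 1 / (1 + (s - p) ^ 2) else 0

/-- Longitudinal derivative `∂_s ψ` at `x = (s, t₂, t₃)`. -/
noncomputable def dS (ψ : ℝ × ℝ × ℝ → ℝ) (x : ℝ × ℝ × ℝ) : ℝ :=
  deriv (fun u => ψ (u, x.2)) x.1

/-- Transverse derivative `∂_{t₂} ψ`. -/
noncomputable def dT2 (ψ : ℝ × ℝ × ℝ → ℝ) (x : ℝ × ℝ × ℝ) : ℝ :=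
  deriv (fun u => ψ (x.1, u, x.2.2)) x.2.1

/-- Transverse derivative `∂_{t₃} ψ`. -/
noncomputable def dT3 (ψ : ℝ × ℝ × ℝ → ℝ) (x : ℝ × ℝ × ℝ) : ℝ :=
  deriv (fun u => ψ (x.1, x.2.1, u)) x.2.2

/-- `|∇'ψ|²`, the squared transverse gradient. -/
noncomputable def gradTsq (ψ : ℝ × ℝ × ℝ → ℝ) (x : ℝ × ℝ × ℝ) : ℝ :=
  (dT2 ψ x) ^ 2 + (dT3 ψ x) ^ 2

/-- The angular derivative `∂_τ ψ = t₂ ∂_{t₃} ψ − t₃ ∂_{t₂} ψ`. -/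
noncomputable def dTau (ψ : ℝ × ℝ × ℝ → ℝ) (x : ℝ × ℝ × ℝ) : ℝ :=
  x.2.1 * dT3 ψ x - x.2.2 * dT2 ψ x

/-- `∂_{t₂} v` for a function on the cross-section. -/
noncomputable def dV2 (v : ℝ × ℝ → ℝ) (t : ℝ × ℝ) : ℝ :=
  deriv (fun u => v (u, t.2)) t.1

/-- `∂_{t₃} v` for a function on the cross-section. -/
noncomputable def dV3 (v : ℝ × ℝ → ℝ) (t : ℝ × ℝ) : ℝ :=
  deriv (fun u => v (t.1, u)) t.2

/-- `|∇v|²` for a function on the cross-section. -/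
noncomputable def gradVsq (v : ℝ × ℝ → ℝ) (t : ℝ × ℝ) : ℝ :=
  (dV2 v t) ^ 2 + (dV3 v t) ^ 2

/-- Angular derivative on the cross-section. -/
noncomputable def dTauV (v : ℝ × ℝ → ℝ) (t : ℝ × ℝ) : ℝ :=
  t.1 * dV3 v t - t.2 * dV2 v t

/-- `v ∈ C_c^∞(ω)`. -/
def TestFun (ω : Set (ℝ × ℝ)) (v : ℝ × ℝ → ℝ) : Prop :=
  ContDiff ℝ (⊤ : ℕ∞) v ∧ HasCompactSupport v ∧ tsupport v ⊆ ω

/-- Admissible functions on `Ω₀ = ℝ × ω`: continuously differentiable on the closure of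
`Ω₀`, square-integrable together with the first partial derivatives, and vanishing on the
Dirichlet part of the boundary, i.e. at `t ∈ ∂ω` for `s ∉ (a, a+l)`. -/
def Admissible (ω : Set (ℝ × ℝ)) (a l : ℝ) (ψ : ℝ × ℝ × ℝ → ℝ) : Prop :=
  ContDiffOn ℝ 1 ψ ((Set.univ : Set ℝ) ×ˢ closure ω) ∧
  IntegrableOn (fun x => (ψ x) ^ 2) ((Set.univ : Set ℝ) ×ˢ ω) ∧
  IntegrableOn (fun x => (dS ψ x) ^ 2) ((Set.univ : Set ℝ) ×ˢ ω) ∧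
  IntegrableOn (fun x => (dT2 ψ x) ^ 2) ((Set.univ : Set ℝ) ×ˢ ω) ∧
  IntegrableOn (fun x => (dT3 ψ x) ^ 2) ((Set.univ : Set ℝ) ×ˢ ω) ∧
  ∀ s t, t ∈ frontier ω → s ∉ Set.Ioo a (a + l) → ψ (s, t) = 0

/-- The potential `g`: zero on the window interval, `E₁` elsewhere. -/
noncomputable def gpot (E₁ a l : ℝ) (s : ℝ) : ℝ := if s ∈ Set.Ioo a (a + l) then 0 else E₁

/-- The localized quadratic form `Q^A(ψ)`. -/
noncomputable def Qform (ω : Set (ℝ × ℝ)) (E₁ : ℝ) (θ : ℝ → ℝ) (A : Set ℝ)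
    (ψ : ℝ × ℝ × ℝ → ℝ) : ℝ :=
  (∫ x in A ×ˢ ω, gradTsq ψ x) - E₁ * (∫ x in A ×ˢ ω, (ψ x) ^ 2)
    + ∫ x in A ×ˢ ω, (dS ψ x + deriv θ x.1 * dTau ψ x) ^ 2

open Filter Topology
open scoped Convolution

lemma dV2_eq_fderiv {v : ℝ × ℝ → ℝ} {t : ℝ × ℝ} (h : DifferentiableAt ℝ v t) :
    dV2 v t = fderiv ℝ v t (1, 0) := by
  have hline : HasDerivAt (fun u : ℝ => (u, t.2)) ((1 : ℝ), (0 : ℝ)) t.1 :=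
    (hasDerivAt_id _).prodMk (hasDerivAt_const _ _)
  exact (HasFDerivAt.comp_hasDerivAt (l := v) t.1 h.hasFDerivAt hline).deriv

lemma dV3_eq_fderiv {v : ℝ × ℝ → ℝ} {t : ℝ × ℝ} (h : DifferentiableAt ℝ v t) :
    dV3 v t = fderiv ℝ v t (0, 1) := by
  have hline : HasDerivAt (fun u : ℝ => (t.1, u)) ((0 : ℝ), (1 : ℝ)) t.2 :=
    (hasDerivAt_const _ _).prodMk (hasDerivAt_id _)
  exact (HasFDerivAt.comp_hasDerivAt (l := v) t.2 h.hasFDerivAt hline).deriv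

lemma continuous_dV2 {v : ℝ × ℝ → ℝ} (hv : ContDiff ℝ 1 v) : Continuous (dV2 v) := by
  have : dV2 v = fun t => fderiv ℝ v t (1, 0) :=
    funext fun t => dV2_eq_fderiv (hv.differentiable one_ne_zero t)
  rw [this]
  exact (hv.continuous_fderiv one_ne_zero).clm_apply continuous_const

lemma continuous_dV3 {v : ℝ × ℝ → ℝ} (hv : ContDiff ℝ 1 v) : Continuous (dV3 v) := by
  have : dV3 v = fun t => fderiv ℝ v t (0, 1) :=
    funext fun t => dV3_eq_fderiv (hv.differentiable one_ne_zero t)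
  rw [this]
  exact (hv.continuous_fderiv one_ne_zero).clm_apply continuous_const

/-- A compactly supported `C¹` function on an open subset of the plane is approximated in `C¹`
by test functions. -/
lemma exists_testFun_close {ω : Set (ℝ × ℝ)} (hω : IsOpen ω) {V : ℝ × ℝ → ℝ}
    (hV : ContDiff ℝ 1 V) (hVc : HasCompactSupport V) (hVω : tsupport V ⊆ ω)
    {η : ℝ} (hη : 0 < η) :
    ∃ w, TestFun ω w ∧ ∀ t, |w t - V t| ≤ η ∧ |dV2 w t - dV2 V t| ≤ η ∧
      |dV3 w t - dV3 V t| ≤ η := by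
  have hV' : Continuous (fderiv ℝ V) := hV.continuous_fderiv one_ne_zero
  obtain ⟨δ₁, hδ₁, h₁⟩ := Metric.uniformContinuous_iff.1
    (hVc.uniformContinuous_of_continuous hV.continuous) η hη
  obtain ⟨δ₂, hδ₂, h₂⟩ := Metric.uniformContinuous_iff.1
    ((hVc.fderiv (𝕜 := ℝ)).uniformContinuous_of_continuous hV') η hη
  obtain ⟨δ₃, hδ₃, h₃⟩ := IsCompact.exists_cthickening_subset_open hVc hω hVω
  set δ := min δ₁ (min δ₂ δ₃) with hδdef
  have hδ : 0 < δ := lt_min hδ₁ (lt_min hδ₂ hδ₃)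
  let φ : ContDiffBump (0 : ℝ × ℝ) := ⟨δ / 2, δ, half_pos hδ, half_lt_self hδ⟩
  set w : ℝ × ℝ → ℝ := φ.normed volume ⋆[ContinuousLinearMap.lsmul ℝ ℝ, volume] V with hw
  have hwsmooth : ContDiff ℝ (⊤ : ℕ∞) w :=
    φ.hasCompactSupport_normed.contDiff_convolution_left _ φ.contDiff_normed
      hV.continuous.locallyIntegrable
  have hwsupp : tsupport w ⊆ Metric.cthickening δ₃ (tsupport V) := by
    refine closure_minimal (fun x hx => ?_) Metric.isClosed_cthickening
    by_contra hxn
    have hz : ∀ y ∈ Metric.ball x φ.rOut, V y = 0 := by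
      intro y hy
      by_contra hVy
      refine hxn (Metric.mem_cthickening_of_dist_le x y δ₃ _ (subset_tsupport _ hVy) ?_)
      rw [dist_comm]
      exact (Metric.mem_ball.1 hy).le.trans ((min_le_right _ _).trans (min_le_right _ _))
    have hx0 := hz x (Metric.mem_ball_self φ.rOut_pos)
    refine hx ?_
    rw [hw, φ.normed_convolution_eq_right (fun y hy => by rw [hz y hy, hx0]), hx0]
  have hwd : ∀ t, dist (fderiv ℝ w t) (fderiv ℝ V t) ≤ η := by
    intro t
    have hder := hVc.hasFDerivAt_convolution_right (μ := volume)
      (f := φ.normed volume) (ContinuousLinearMap.lsmul ℝ ℝ)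
      (φ.continuous_normed.locallyIntegrable) hV t
    rw [hder.fderiv]
    refine φ.dist_normed_convolution_le hV'.aestronglyMeasurable fun x hx => ?_
    exact (h₂ ((Metric.mem_ball.1 hx).trans_le
      ((min_le_right _ _).trans (min_le_left _ _)))).le
  have hwdiff : Differentiable ℝ w := hwsmooth.differentiable (by simp)
  have hVdiff : Differentiable ℝ V := hV.differentiable one_ne_zero
  have hdir : ∀ t e, ‖e‖ = 1 → |fderiv ℝ w t e - fderiv ℝ V t e| ≤ η := by
    intro t e he
    have := (fderiv ℝ w t - fderiv ℝ V t).le_opNorm e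
    rw [he, mul_one, ← dist_eq_norm] at this
    exact this.trans (hwd t)
  refine ⟨w, ⟨hwsmooth, ?_, hwsupp.trans h₃⟩, fun t => ⟨?_, ?_, ?_⟩⟩
  · exact (hVc.isCompact.cthickening).of_isClosed_subset (isClosed_tsupport _) hwsupp
  · refine φ.dist_normed_convolution_le hV.continuous.aestronglyMeasurable fun x hx => ?_
    exact (h₁ ((Metric.mem_ball.1 hx).trans_le (min_le_left _ _))).le
  · rw [dV2_eq_fderiv (hwdiff t), dV2_eq_fderiv (hVdiff t)]
    exact hdir t _ (by simp)
  · rw [dV3_eq_fderiv (hwdiff t), dV3_eq_fderiv (hVdiff t)]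
    exact hdir t _ (by simp)

/-- The Dirichlet form inequality passes from test functions to compactly supported `C¹`
functions. -/
lemma poincare_of_contDiff_one {ω : Set (ℝ × ℝ)} (hω : IsOpen ω) (hb : Bornology.IsBounded ω)
    {E : ℝ} (hE : ∀ w, TestFun ω w → E * ∫ t in ω, (w t) ^ 2 ≤ ∫ t in ω, gradVsq w t)
    {V : ℝ × ℝ → ℝ} (hV : ContDiff ℝ 1 V) (hVc : HasCompactSupport V) (hVω : tsupport V ⊆ ω) :
    E * ∫ t in ω, (V t) ^ 2 ≤ ∫ t in ω, gradVsq V t := by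
  have hη : ∀ n : ℕ, (0 : ℝ) < 1 / ((n : ℝ) + 1) := fun n => Nat.one_div_pos_of_nat
  choose w hw hclose using fun n : ℕ => exists_testFun_close hω hV hVc hVω (hη n)
  have hw1 : ∀ n, ContDiff ℝ 1 (w n) := fun n => (hw n).1.of_le (by exact_mod_cast le_top)
  have : IsFiniteMeasure (volume.restrict ω) :=
    ⟨by simpa using hb.measure_lt_top⟩
  have hK : IsCompact (closure ω) := hb.isCompact_closure
  have key : ∀ (f : ℝ × ℝ → ℝ) (g : ℕ → ℝ × ℝ → ℝ), Continuous f → (∀ n, Continuous (g n)) →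
      (∀ n t, |g n t - f t| ≤ 1 / ((n : ℝ) + 1)) →
      Tendsto (fun n => ∫ t in ω, (g n t) ^ 2) atTop (𝓝 (∫ t in ω, (f t) ^ 2)) ∧
      ∀ n, IntegrableOn (fun t => (g n t) ^ 2) ω := by
    intro f g hf hg hfg
    refine ⟨?_, fun n => (((hg n).pow 2).continuousOn.integrableOn_compact hK).mono_set
      subset_closure⟩
    obtain ⟨B, hB⟩ := hK.exists_bound_of_continuousOn hf.continuousOn
    refine tendsto_integral_of_dominated_convergence (fun _ => (B + 1) ^ 2)
      (fun n => ((hg n).pow 2).aestronglyMeasurable) (integrable_const _) (fun n => ?_)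
      (ae_of_all _ fun t => ?_)
    · refine (ae_restrict_iff' hω.measurableSet).2 (ae_of_all _ fun t ht => ?_)
      have h1 := hB t (subset_closure ht)
      have h2 := hfg n t
      have h3 : 1 / ((n : ℝ) + 1) ≤ 1 := by
        rw [div_le_one (by positivity)]; linarith [Nat.cast_nonneg (α := ℝ) n]
      rw [norm_pow]
      refine pow_le_pow_left₀ (norm_nonneg _) ?_ 2
      have := norm_sub_norm_le (g n t) (f t)
      rw [Real.norm_eq_abs (g n t - f t)] at this
      linarith
    · refine Tendsto.pow ?_ 2
      rw [tendsto_iff_norm_sub_tendsto_zero]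
      exact squeeze_zero (fun _ => norm_nonneg _) (fun n => hfg n t)
        tendsto_one_div_add_atTop_nhds_zero_nat
  have k0 := key V w hV.continuous (fun n => (hw1 n).continuous) fun n t => (hclose n t).1
  have k2 := key (dV2 V) (fun n => dV2 (w n)) (continuous_dV2 hV) (fun n => continuous_dV2 (hw1 n))
    fun n t => (hclose n t).2.1
  have k3 := key (dV3 V) (fun n => dV3 (w n)) (continuous_dV3 hV) (fun n => continuous_dV3 (hw1 n))
    fun n t => (hclose n t).2.2
  have i2 : IntegrableOn (fun t => (dV2 V t) ^ 2) ω :=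
    (((continuous_dV2 hV).pow 2).continuousOn.integrableOn_compact hK).mono_set subset_closure
  have i3 : IntegrableOn (fun t => (dV3 V t) ^ 2) ω :=
    (((continuous_dV3 hV).pow 2).continuousOn.integrableOn_compact hK).mono_set subset_closure
  refine le_of_tendsto_of_tendsto' (k0.1.const_mul E) ?_ fun n => hE (w n) (hw n)
  simp only [gradVsq]
  rw [integral_add i2 i3]
  refine (k2.1.add k3.1).congr fun n => ?_
  rw [integral_add (k2.2 n) (k3.2 n)]

/-- Slope of the truncation: vanishes near `0` and equals `1` away from `0`. -/
noncomputable def truncSlope (n : ℕ) (y : ℝ) : ℝ := min 1 (max 0 (((n : ℝ) + 1) * |y| - 1))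

/-- A `C¹` contraction of the line which vanishes near `0` and tends to the identity. -/
noncomputable def trunc (n : ℕ) (x : ℝ) : ℝ := ∫ y in (0 : ℝ)..x, truncSlope n y

lemma continuous_truncSlope (n : ℕ) : Continuous (truncSlope n) := by
  unfold truncSlope; fun_prop

lemma truncSlope_nonneg (n : ℕ) (y : ℝ) : 0 ≤ truncSlope n y :=
  le_min zero_le_one (le_max_left _ _)

lemma truncSlope_le_one (n : ℕ) (y : ℝ) : truncSlope n y ≤ 1 := min_le_left _ _

lemma tendsto_truncSlope {y : ℝ} (hy : y ≠ 0) :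
    Tendsto (fun n => truncSlope n y) atTop (𝓝 1) := by
  refine tendsto_const_nhds.congr' ?_
  have h : Tendsto (fun n : ℕ => ((n : ℝ) + 1) * |y|) atTop atTop :=
    (tendsto_natCast_atTop_atTop.atTop_add tendsto_const_nhds).atTop_mul_const (abs_pos.2 hy)
  filter_upwards [h.eventually_ge_atTop 2] with n hn
  rw [truncSlope, min_eq_left]
  exact le_max_of_le_right (by linarith)

lemma hasDerivAt_trunc (n : ℕ) (x : ℝ) : HasDerivAt (trunc n) (truncSlope n x) x :=
  intervalIntegral.integral_hasDerivAt_right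
    ((continuous_truncSlope n).intervalIntegrable _ _)
    ((continuous_truncSlope n).stronglyMeasurableAtFilter _ _)
    (continuous_truncSlope n).continuousAt

lemma contDiff_trunc (n : ℕ) : ContDiff ℝ 1 (trunc n) := by
  refine contDiff_one_iff_deriv.2 ⟨fun x => (hasDerivAt_trunc n x).differentiableAt, ?_⟩
  rw [funext fun x => (hasDerivAt_trunc n x).deriv]
  exact continuous_truncSlope n

lemma abs_trunc_le (n : ℕ) (x : ℝ) : |trunc n x| ≤ |x| := by
  have := intervalIntegral.norm_integral_le_of_norm_le_const (a := 0) (b := x) (C := 1)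
    (f := truncSlope n) fun y _ => by
      rw [Real.norm_eq_abs, abs_of_nonneg (truncSlope_nonneg n y)]
      exact truncSlope_le_one n y
  simpa [trunc] using this

lemma trunc_eq_zero {n : ℕ} {x : ℝ} (hx : |x| ≤ 1 / ((n : ℝ) + 1)) : trunc n x = 0 := by
  have hn : (0 : ℝ) < (n : ℝ) + 1 := by positivity
  rw [trunc, intervalIntegral.integral_congr (g := fun _ => (0 : ℝ)), intervalIntegral.integral_zero]
  intro y hy
  have hyx : |y| ≤ |x| := by
    simpa using abs_sub_left_of_mem_uIcc hy
  have : |y| * ((n : ℝ) + 1) ≤ 1 := (le_div_iff₀ hn).1 (hyx.trans hx)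
  simp only [truncSlope]
  rw [max_eq_left (by linarith)]
  simp

lemma tendsto_trunc (x : ℝ) : Tendsto (fun n => trunc n x) atTop (𝓝 x) := by
  have h : Tendsto (fun n => trunc n x) atTop (𝓝 (∫ _ in (0 : ℝ)..x, (1 : ℝ))) := by
    refine intervalIntegral.tendsto_integral_filter_of_dominated_convergence (fun _ => 1)
      (Eventually.of_forall fun n => (continuous_truncSlope n).aestronglyMeasurable)
      (Eventually.of_forall fun n => ae_of_all _ fun y _ => ?_) intervalIntegrable_const ?_
    · rw [Real.norm_eq_abs, abs_of_nonneg (truncSlope_nonneg n y)]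
      exact truncSlope_le_one n y
    · filter_upwards [compl_mem_ae_iff.2 (measure_singleton (0 : ℝ))] with y hy _
      exact tendsto_truncSlope hy
  simpa using h

/-- Truncation of a function on the cross-section, extended by zero. -/
noncomputable def truncExt (ω : Set (ℝ × ℝ)) (n : ℕ) (v : ℝ × ℝ → ℝ) : ℝ × ℝ → ℝ :=
  ω.indicator fun t => trunc n (v t)

section Slice

variable {ω : Set (ℝ × ℝ)} {v : ℝ × ℝ → ℝ}

lemma truncExt_eventuallyEq_zero (hv : ContinuousOn v (closure ω))
    (hv0 : ∀ t ∈ frontier ω, v t = 0) (n : ℕ) {t : ℝ × ℝ} (ht : t ∉ ω) :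
    truncExt ω n v =ᶠ[𝓝 t] 0 := by
  by_cases htc : t ∈ closure ω
  · have h0 : v t = 0 := hv0 t ⟨htc, fun h => ht (interior_subset h)⟩
    have hsmall : ∀ᶠ y in 𝓝[closure ω] t, |v y| < 1 / ((n : ℝ) + 1) := by
      have hc := (hv t htc).abs
      refine hc.eventually_lt_const ?_
      simp only [h0, abs_zero]
      positivity
    filter_upwards [eventually_nhdsWithin_iff.1 hsmall] with y hy
    by_cases hyω : y ∈ ω
    · simpa [truncExt, hyω] using trunc_eq_zero (hy (subset_closure hyω)).le
    · simp [truncExt, hyω]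
  · filter_upwards [isClosed_closure.isOpen_compl.mem_nhds htc] with y hy
    have hyω : y ∉ ω := fun h => hy (subset_closure h)
    simp [truncExt, hyω]

lemma tsupport_truncExt_subset (hv : ContinuousOn v (closure ω))
    (hv0 : ∀ t ∈ frontier ω, v t = 0) (n : ℕ) : tsupport (truncExt ω n v) ⊆ ω := by
  intro t ht
  by_contra htω
  exact notMem_tsupport_iff_eventuallyEq.2 (truncExt_eventuallyEq_zero hv hv0 n htω) ht

lemma hasCompactSupport_truncExt (hb : Bornology.IsBounded ω) (n : ℕ) :
    HasCompactSupport (truncExt ω n v) :=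
  HasCompactSupport.of_support_subset_isCompact hb.isCompact_closure
    (support_indicator_subset.trans subset_closure)

lemma truncExt_eventuallyEq (hω : IsOpen ω) (n : ℕ) {t : ℝ × ℝ} (ht : t ∈ ω) :
    truncExt ω n v =ᶠ[𝓝 t] fun t => trunc n (v t) := by
  filter_upwards [hω.mem_nhds ht] with y hy
  simp [truncExt, hy]

lemma contDiff_truncExt (hω : IsOpen ω) (hv : ContDiffOn ℝ 1 v (closure ω))
    (hv0 : ∀ t ∈ frontier ω, v t = 0) (n : ℕ) : ContDiff ℝ 1 (truncExt ω n v) := by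
  refine contDiff_iff_contDiffAt.2 fun t => ?_
  by_cases ht : t ∈ ω
  · have hvt : ContDiffAt ℝ 1 v t := hv.contDiffAt (mem_of_superset (hω.mem_nhds ht) subset_closure)
    exact ((contDiff_trunc n).contDiffAt.comp t hvt).congr_of_eventuallyEq
      (truncExt_eventuallyEq hω n ht)
  · exact contDiffAt_const.congr_of_eventuallyEq
      (truncExt_eventuallyEq_zero hv.continuousOn hv0 n ht)

lemma fderiv_truncExt (hω : IsOpen ω) (n : ℕ) {t : ℝ × ℝ} (ht : t ∈ ω)
    (hvt : DifferentiableAt ℝ v t) :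
    fderiv ℝ (truncExt ω n v) t = truncSlope n (v t) • fderiv ℝ v t := by
  rw [(truncExt_eventuallyEq hω n ht).fderiv_eq]
  exact ((hasDerivAt_trunc n (v t)).comp_hasFDerivAt t hvt.hasFDerivAt).fderiv

lemma dV2_truncExt (hω : IsOpen ω) (hv : ContDiffOn ℝ 1 v (closure ω))
    (hv0 : ∀ t ∈ frontier ω, v t = 0) (n : ℕ) {t : ℝ × ℝ} (ht : t ∈ ω) :
    dV2 (truncExt ω n v) t = truncSlope n (v t) * dV2 v t := by
  have hvt : DifferentiableAt ℝ v t :=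
    (hv.contDiffAt (mem_of_superset (hω.mem_nhds ht) subset_closure)).differentiableAt one_ne_zero
  rw [dV2_eq_fderiv ((contDiff_truncExt hω hv hv0 n).differentiable one_ne_zero t),
    fderiv_truncExt hω n ht hvt, dV2_eq_fderiv hvt]
  simp

lemma dV3_truncExt (hω : IsOpen ω) (hv : ContDiffOn ℝ 1 v (closure ω))
    (hv0 : ∀ t ∈ frontier ω, v t = 0) (n : ℕ) {t : ℝ × ℝ} (ht : t ∈ ω) :
    dV3 (truncExt ω n v) t = truncSlope n (v t) * dV3 v t := by
  have hvt : DifferentiableAt ℝ v t :=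
    (hv.contDiffAt (mem_of_superset (hω.mem_nhds ht) subset_closure)).differentiableAt one_ne_zero
  rw [dV3_eq_fderiv ((contDiff_truncExt hω hv hv0 n).differentiable one_ne_zero t),
    fderiv_truncExt hω n ht hvt, dV3_eq_fderiv hvt]
  simp

/-- The Dirichlet form inequality for functions which are `C¹` up to the boundary and vanish
there. -/
lemma poincare_of_contDiffOn_closure (hω : IsOpen ω) (hb : Bornology.IsBounded ω)
    {E : ℝ} (hE : ∀ w, TestFun ω w → E * ∫ t in ω, (w t) ^ 2 ≤ ∫ t in ω, gradVsq w t)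
    (hv : ContDiffOn ℝ 1 v (closure ω)) (hv0 : ∀ t ∈ frontier ω, v t = 0)
    (hi : IntegrableOn (fun t => (v t) ^ 2) ω) (hg : IntegrableOn (gradVsq v) ω) :
    E * ∫ t in ω, (v t) ^ 2 ≤ ∫ t in ω, gradVsq v t := by
  have hlim : Tendsto (fun n => ∫ t in ω, (truncExt ω n v t) ^ 2) atTop
      (𝓝 (∫ t in ω, (v t) ^ 2)) := by
    refine tendsto_integral_of_dominated_convergence (fun t => (v t) ^ 2)
      (fun n => ((contDiff_truncExt hω hv hv0 n).continuous.pow 2).aestronglyMeasurable) hi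
      (fun n => ?_) ?_
    · refine (ae_restrict_iff' hω.measurableSet).2 (ae_of_all _ fun t ht => ?_)
      rw [truncExt, indicator_of_mem ht, Real.norm_eq_abs, abs_of_nonneg (sq_nonneg _)]
      exact sq_le_sq.2 (abs_trunc_le n _)
    · refine (ae_restrict_iff' hω.measurableSet).2 (ae_of_all _ fun t ht => ?_)
      simp only [truncExt, indicator_of_mem ht]
      exact (tendsto_trunc _).pow 2
  refine le_of_tendsto' (hlim.const_mul E) fun n => ?_
  have hC := contDiff_truncExt hω hv hv0 n
  refine (poincare_of_contDiff_one hω hb hE hC (hasCompactSupport_truncExt hb n)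
    (tsupport_truncExt_subset hv.continuousOn hv0 n)).trans ?_
  refine setIntegral_mono_on ?_ hg hω.measurableSet fun t ht => ?_
  · have hc : Continuous (gradVsq (truncExt ω n v)) :=
      ((continuous_dV2 hC).pow 2).add ((continuous_dV3 hC).pow 2)
    exact (hc.continuousOn.integrableOn_compact hb.isCompact_closure).mono_set subset_closure
  · have h1 : truncSlope n (v t) ^ 2 ≤ 1 :=
      pow_le_one₀ (truncSlope_nonneg n _) (truncSlope_le_one n _)
    simp only [gradVsq]
    rw [dV2_truncExt hω hv hv0 n ht, dV3_truncExt hω hv hv0 n ht, mul_pow, mul_pow]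
    nlinarith [sq_nonneg (dV2 v t), sq_nonneg (dV3 v t)]

/-- Multiplication by a coordinate constant in the direction `e` does not affect integration by
parts. -/
lemma integral_mul_mul_fderiv_self_eq_zero {V c : ℝ × ℝ → ℝ} (hV : ContDiff ℝ 1 V)
    (hVc : HasCompactSupport V) (hc : ContDiff ℝ 1 c) {e : ℝ × ℝ}
    (hce : ∀ t, fderiv ℝ c t e = 0) :
    ∫ t, c t * V t * fderiv ℝ V t e = 0 := by
  have hVd : Differentiable ℝ V := hV.differentiable one_ne_zero
  have hcd : Differentiable ℝ c := hc.differentiable one_ne_zero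
  have hV' : Continuous fun t => fderiv ℝ V t e :=
    (hV.continuous_fderiv one_ne_zero).clm_apply continuous_const
  have hf : ∀ t, fderiv ℝ (fun t => c t * V t) t e = c t * fderiv ℝ V t e := by
    intro t
    rw [fderiv_fun_mul (hcd t) (hVd t)]
    simp [hce t]
  have hi1 : Integrable fun t => c t * V t * fderiv ℝ V t e :=
    ((hc.continuous.mul hV.continuous).mul hV').integrable_of_hasCompactSupport
      (hVc.mul_left.mul_right)
  have hi2 : Integrable fun t => c t * V t * V t :=
    ((hc.continuous.mul hV.continuous).mul hV.continuous).integrable_of_hasCompactSupport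
      (hVc.mul_left)
  have heq : ∀ t, fderiv ℝ (fun t => c t * V t) t e * V t = c t * V t * fderiv ℝ V t e := by
    intro t; rw [hf]; ring
  have := integral_mul_fderiv_eq_neg_fderiv_mul_of_integrable (μ := volume)
    (f := fun t => c t * V t) (g := V) (v := e)
    (hi1.congr (ae_of_all _ fun t => (heq t).symm)) hi1 hi2
    (fun t _ => (hcd t).mul (hVd t)) (fun t _ => hVd t)
  rw [integral_congr_ae (ae_of_all _ heq)] at this
  linarith

lemma integral_mul_dTauV_eq_zero_of_contDiff {V : ℝ × ℝ → ℝ} (hV : ContDiff ℝ 1 V)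
    (hVc : HasCompactSupport V) : ∫ t, V t * dTauV V t = 0 := by
  have hVd : Differentiable ℝ V := hV.differentiable one_ne_zero
  have h1 := integral_mul_mul_fderiv_self_eq_zero hV hVc (c := Prod.fst) contDiff_fst
    (e := (0, 1)) (fun t => by simp [fderiv_fst])
  have h2 := integral_mul_mul_fderiv_self_eq_zero hV hVc (c := Prod.snd) contDiff_snd
    (e := (1, 0)) (fun t => by simp [fderiv_snd])
  have hcont : ∀ e, Continuous fun t => fderiv ℝ V t e := fun e =>
    (hV.continuous_fderiv one_ne_zero).clm_apply continuous_const
  have i1 : Integrable fun t => t.1 * V t * fderiv ℝ V t (0, 1) :=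
    ((continuous_fst.mul hV.continuous).mul (hcont _)).integrable_of_hasCompactSupport
      (hVc.mul_left.mul_right)
  have i2 : Integrable fun t => t.2 * V t * fderiv ℝ V t (1, 0) :=
    ((continuous_snd.mul hV.continuous).mul (hcont _)).integrable_of_hasCompactSupport
      (hVc.mul_left.mul_right)
  have : ∀ t, V t * dTauV V t
      = t.1 * V t * fderiv ℝ V t (0, 1) - t.2 * V t * fderiv ℝ V t (1, 0) := by
    intro t
    rw [dTauV, dV2_eq_fderiv (hVd t), dV3_eq_fderiv (hVd t)]
    ring
  rw [integral_congr_ae (ae_of_all _ this), integral_sub i1 i2, h1, h2, sub_zero]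

/-- The angular derivative is skew-symmetric on functions vanishing on the boundary. -/
lemma integral_mul_dTauV_eq_zero (hω : IsOpen ω) (hb : Bornology.IsBounded ω)
    (hv : ContDiffOn ℝ 1 v (closure ω)) (hv0 : ∀ t ∈ frontier ω, v t = 0)
    (hi : IntegrableOn (fun t => v t * dTauV v t) ω) :
    ∫ t in ω, v t * dTauV v t = 0 := by
  have hprod : ∀ n, ∀ t ∈ ω, truncExt ω n v t * dTauV (truncExt ω n v) t
      = trunc n (v t) * truncSlope n (v t) * dTauV v t := by
    intro n t ht
    rw [dTauV, dV2_truncExt hω hv hv0 n ht, dV3_truncExt hω hv hv0 n ht, dTauV, truncExt,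
      indicator_of_mem ht]
    ring
  have hlim : Tendsto (fun n => ∫ t in ω, truncExt ω n v t * dTauV (truncExt ω n v) t) atTop
      (𝓝 (∫ t in ω, v t * dTauV v t)) := by
    refine tendsto_integral_of_dominated_convergence (fun t => |v t * dTauV v t|)
      (fun n => ?_) hi.abs (fun n => ?_) ?_
    · have hC := contDiff_truncExt hω hv hv0 n
      exact (hC.continuous.mul ((continuous_fst.mul (continuous_dV3 hC)).sub
        (continuous_snd.mul (continuous_dV2 hC)))).aestronglyMeasurable
    · refine (ae_restrict_iff' hω.measurableSet).2 (ae_of_all _ fun t ht => ?_)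
      rw [hprod n t ht, Real.norm_eq_abs, abs_mul, abs_mul, abs_mul,
        abs_of_nonneg (truncSlope_nonneg n _)]
      have h1 := abs_trunc_le n (v t)
      have h2 := truncSlope_le_one n (v t)
      have h3 := truncSlope_nonneg n (v t)
      gcongr
      exact (mul_le_of_le_one_right (abs_nonneg _) h2).trans h1
    · refine (ae_restrict_iff' hω.measurableSet).2 (ae_of_all _ fun t ht => ?_)
      simp only [hprod _ t ht]
      by_cases h0 : v t = 0
      · simp [h0, trunc]
      · simpa using ((tendsto_trunc (v t)).mul (tendsto_truncSlope h0)).mul_const (dTauV v t)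
  refine tendsto_nhds_unique hlim (tendsto_const_nhds.congr fun n => ?_)
  rw [setIntegral_eq_integral_of_forall_compl_eq_zero fun t ht => by simp [truncExt, ht]]
  exact (integral_mul_dTauV_eq_zero_of_contDiff (contDiff_truncExt hω hv hv0 n)
    (hasCompactSupport_truncExt hb n)).symm

end Slice

/-- The vector field behind the Hardy inequality on `(-∞, p)` with a defect on `(p - r, p)`. -/
noncomputable def hardyField (p r s : ℝ) : ℝ := (s - p) / (2 * (r ^ 2 / 4 + (s - p) ^ 2))

/-- The derivative of `hardyField`. -/
noncomputable def hardyFieldDeriv (p r s : ℝ) : ℝ :=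
  (r ^ 2 / 4 - (s - p) ^ 2) / (2 * (r ^ 2 / 4 + (s - p) ^ 2) ^ 2)

section HardyField

variable {p r : ℝ}

lemma hasDerivAt_hardyField (hr : 0 < r) (s : ℝ) :
    HasDerivAt (hardyField p r) (hardyFieldDeriv p r s) s := by
  have hpos : 0 < r ^ 2 / 4 + (s - p) ^ 2 := by positivity
  have h1 : HasDerivAt (fun s : ℝ => s - p) 1 s := (hasDerivAt_id s).sub_const p
  have h2 : HasDerivAt (fun s : ℝ => 2 * (r ^ 2 / 4 + (s - p) ^ 2)) (2 * (2 * (s - p))) s := by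
    simpa using ((h1.pow 2).const_add (r ^ 2 / 4)).const_mul 2
  refine (h1.div h2 (by positivity)).congr_deriv ?_
  rw [hardyFieldDeriv]
  field_simp
  ring

lemma continuous_hardyField (hr : 0 < r) : Continuous (hardyField p r) :=
  continuous_iff_continuousAt.2 fun s => (hasDerivAt_hardyField hr s).continuousAt

lemma continuous_hardyFieldDeriv (hr : 0 < r) : Continuous (hardyFieldDeriv p r) := by
  unfold hardyFieldDeriv
  refine Continuous.div (by fun_prop) (by fun_prop) fun s => ?_
  positivity

lemma abs_hardyField_le (hr : 0 < r) (s : ℝ) : |hardyField p r s| ≤ 1 / (2 * r) := by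
  have hpos : 0 < 2 * (r ^ 2 / 4 + (s - p) ^ 2) := by positivity
  rw [hardyField, abs_div, abs_of_pos hpos, div_le_div_iff₀ hpos (by positivity), ← sq_abs (s - p)]
  nlinarith [sq_nonneg (r / 2 - |s - p|)]

lemma abs_hardyFieldDeriv_le (hr : 0 < r) (s : ℝ) : |hardyFieldDeriv p r s| ≤ 2 / r ^ 2 := by
  have hpos : 0 < r ^ 2 / 4 + (s - p) ^ 2 := by positivity
  have hnum : |r ^ 2 / 4 - (s - p) ^ 2| ≤ r ^ 2 / 4 + (s - p) ^ 2 :=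
    abs_le.2 ⟨by nlinarith [sq_nonneg r], by nlinarith [sq_nonneg (s - p)]⟩
  have hd : 0 < 2 * (r ^ 2 / 4 + (s - p) ^ 2) ^ 2 := by positivity
  rw [hardyFieldDeriv, abs_div, abs_of_pos hd, div_le_div_iff₀ hd (by positivity)]
  nlinarith [mul_le_mul_of_nonneg_right hnum (sq_nonneg r),
    mul_nonneg hpos.le (sq_nonneg (s - p))]

lemma rho_nonneg (s : ℝ) : 0 ≤ rho p s := by
  unfold rho; split_ifs <;> positivity

lemma rho_le_one (s : ℝ) : rho p s ≤ 1 := by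
  unfold rho
  split_ifs
  · rw [div_le_one (by positivity)]; nlinarith [sq_nonneg (s - p)]
  · exact zero_le_one

lemma measurable_rho : Measurable (rho p) := by
  unfold rho
  exact Measurable.ite measurableSet_Iic (by fun_prop) measurable_const

lemma hardyField_potential_eq (hr : 0 < r) (s : ℝ) :
    -hardyFieldDeriv p r s - hardyField p r s ^ 2
      = ((s - p) ^ 2 / 2 - r ^ 2 / 4) / (2 * (r ^ 2 / 4 + (s - p) ^ 2) ^ 2) := by
  have hpos : 0 < r ^ 2 / 4 + (s - p) ^ 2 := by positivity
  rw [hardyFieldDeriv, hardyField]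
  field_simp
  ring

lemma rho_le_hardyField_potential (hr : 0 < r) {s : ℝ} (hs : s ≤ p - r) :
    2 / 25 * rho p s ≤ -hardyFieldDeriv p r s - hardyField p r s ^ 2 := by
  have hpos : 0 < r ^ 2 / 4 + (s - p) ^ 2 := by positivity
  rw [hardyField_potential_eq hr, rho, if_pos (by linarith)]
  have hy : r ^ 2 ≤ (s - p) ^ 2 := by nlinarith
  generalize (s - p) ^ 2 = y at *
  have hy0 : 0 < y := by nlinarith
  rw [div_mul_div_comm, div_le_div_iff₀ (by positivity) (by positivity)]
  have h1 : (r ^ 2 / 4 + y) ^ 2 ≤ (5 / 4 * y) ^ 2 := by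
    refine pow_le_pow_left₀ hpos.le ?_ 2; linarith
  have h2 : y / 4 ≤ y / 2 - r ^ 2 / 4 := by linarith
  nlinarith [mul_le_mul_of_nonneg_right h2 (by positivity : 0 ≤ 25 * (1 + y))]

lemma neg_le_hardyField_potential (hr : 0 < r) (s : ℝ) :
    -(2 / r ^ 2) ≤ -hardyFieldDeriv p r s - hardyField p r s ^ 2 := by
  have hpos : 0 < r ^ 2 / 4 + (s - p) ^ 2 := by positivity
  rw [hardyField_potential_eq hr, ← neg_div, div_le_div_iff₀ (by positivity) (by positivity)]
  nlinarith [mul_nonneg (sq_nonneg r) (sq_nonneg (s - p)), sq_nonneg ((s - p) ^ 2)]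

end HardyField

/-- The twisted longitudinal derivative `∂_s ψ + θ' ∂_τ ψ`. -/
noncomputable def dTwist (θ : ℝ → ℝ) (ψ : ℝ × ℝ × ℝ → ℝ) (x : ℝ × ℝ × ℝ) : ℝ :=
  dS ψ x + deriv θ x.1 * dTau ψ x

section Partials

variable {ψ : ℝ × ℝ × ℝ → ℝ} {x : ℝ × ℝ × ℝ}

lemma hasDerivAt_longitudinal (h : DifferentiableAt ℝ ψ x) :
    HasDerivAt (fun u => ψ (u, x.2)) (fderiv ℝ ψ x (1, 0, 0)) x.1 := by
  have hline : HasDerivAt (fun u : ℝ => (u, x.2)) ((1 : ℝ), ((0 : ℝ), (0 : ℝ))) x.1 :=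
    (hasDerivAt_id _).prodMk (hasDerivAt_const _ _)
  exact HasFDerivAt.comp_hasDerivAt (l := ψ) x.1 h.hasFDerivAt hline

lemma dS_eq_fderiv (h : DifferentiableAt ℝ ψ x) : dS ψ x = fderiv ℝ ψ x (1, 0, 0) :=
  (hasDerivAt_longitudinal h).deriv

lemma dT2_eq_fderiv (h : DifferentiableAt ℝ ψ x) : dT2 ψ x = fderiv ℝ ψ x (0, 1, 0) := by
  have hline : HasDerivAt (fun u : ℝ => (x.1, u, x.2.2)) ((0 : ℝ), ((1 : ℝ), (0 : ℝ))) x.2.1 :=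
    (hasDerivAt_const _ _).prodMk ((hasDerivAt_id _).prodMk (hasDerivAt_const _ _))
  exact (HasFDerivAt.comp_hasDerivAt (l := ψ) x.2.1 h.hasFDerivAt hline).deriv

lemma dT3_eq_fderiv (h : DifferentiableAt ℝ ψ x) : dT3 ψ x = fderiv ℝ ψ x (0, 0, 1) := by
  have hline : HasDerivAt (fun u : ℝ => (x.1, x.2.1, u)) ((0 : ℝ), ((0 : ℝ), (1 : ℝ))) x.2.2 :=
    (hasDerivAt_const _ _).prodMk ((hasDerivAt_const _ _).prodMk (hasDerivAt_id _))
  exact (HasFDerivAt.comp_hasDerivAt (l := ψ) x.2.2 h.hasFDerivAt hline).deriv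

end Partials

lemma volume_restrict_prod (A : Set ℝ) (ω : Set (ℝ × ℝ)) :
    (volume : Measure (ℝ × ℝ × ℝ)).restrict (A ×ˢ ω)
      = (volume.restrict A).prod (volume.restrict ω) := by
  rw [Measure.prod_restrict]; rfl

namespace Admissible

variable {ω : Set (ℝ × ℝ)} {a l : ℝ} {ψ : ℝ × ℝ × ℝ → ℝ}

lemma differentiableAt (hω : IsOpen ω) (h : Admissible ω a l ψ) {x : ℝ × ℝ × ℝ}
    (hx : x.2 ∈ ω) : DifferentiableAt ℝ ψ x := by
  refine (h.1.contDiffAt (mem_of_superset ((isOpen_univ.prod hω).mem_nhds ⟨mem_univ _, hx⟩)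
    ?_)).differentiableAt one_ne_zero
  exact prod_mono subset_rfl subset_closure

lemma continuousOn_fderiv_apply (hω : IsOpen ω) (h : Admissible ω a l ψ) (e : ℝ × ℝ × ℝ) :
    ContinuousOn (fun x => fderiv ℝ ψ x e) (univ ×ˢ ω) :=
  ((h.1.mono (prod_mono subset_rfl subset_closure)).continuousOn_fderiv_of_isOpen
    (isOpen_univ.prod hω) le_rfl).clm_apply continuousOn_const

lemma memLp (hω : IsOpen ω) (h : Admissible ω a l ψ) :
    MemLp ψ 2 (volume.restrict (univ ×ˢ ω)) :=
  (memLp_two_iff_integrable_sq ((h.1.continuousOn.mono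
    (prod_mono subset_rfl subset_closure)).aestronglyMeasurable
      (isOpen_univ.prod hω).measurableSet)).2 h.2.1

lemma memLp_dS (hω : IsOpen ω) (h : Admissible ω a l ψ) :
    MemLp (dS ψ) 2 (volume.restrict (univ ×ˢ ω)) :=
  (memLp_two_iff_integrable_sq (((h.continuousOn_fderiv_apply hω _).congr fun _ hx =>
    dS_eq_fderiv (h.differentiableAt hω hx.2)).aestronglyMeasurable
      (isOpen_univ.prod hω).measurableSet)).2 h.2.2.1

lemma memLp_dT2 (hω : IsOpen ω) (h : Admissible ω a l ψ) :
    MemLp (dT2 ψ) 2 (volume.restrict (univ ×ˢ ω)) :=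
  (memLp_two_iff_integrable_sq (((h.continuousOn_fderiv_apply hω _).congr fun _ hx =>
    dT2_eq_fderiv (h.differentiableAt hω hx.2)).aestronglyMeasurable
      (isOpen_univ.prod hω).measurableSet)).2 h.2.2.2.1

lemma memLp_dT3 (hω : IsOpen ω) (h : Admissible ω a l ψ) :
    MemLp (dT3 ψ) 2 (volume.restrict (univ ×ˢ ω)) :=
  (memLp_two_iff_integrable_sq (((h.continuousOn_fderiv_apply hω _).congr fun _ hx =>
    dT3_eq_fderiv (h.differentiableAt hω hx.2)).aestronglyMeasurable
      (isOpen_univ.prod hω).measurableSet)).2 h.2.2.2.2.1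

lemma memLp_dTau (hω : IsOpen ω) {d : ℝ} (hd : ∀ t ∈ ω, ‖t‖ ≤ d) (h : Admissible ω a l ψ) :
    MemLp (dTau ψ) 2 (volume.restrict (univ ×ˢ ω)) := by
  have hm := (isOpen_univ (X := ℝ)).prod hω |>.measurableSet
  have h3 := h.memLp_dT3 hω
  have h2 := h.memLp_dT2 hω
  have m1 : AEStronglyMeasurable (fun x : ℝ × ℝ × ℝ => x.2.1)
    (volume.restrict (univ ×ˢ ω)) := by fun_prop
  have m2 : AEStronglyMeasurable (fun x : ℝ × ℝ × ℝ => x.2.2)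
    (volume.restrict (univ ×ˢ ω)) := by fun_prop
  refine MemLp.sub
    (h3.of_le_mul (c := d) (m1.mul h3.aestronglyMeasurable) ?_)
    (h2.of_le_mul (c := d) (m2.mul h2.aestronglyMeasurable) ?_)
  · refine (ae_restrict_iff' hm).2 (ae_of_all _ fun x hx => ?_)
    simp only [norm_mul]
    gcongr
    exact (norm_fst_le x.2).trans (hd _ hx.2)
  · refine (ae_restrict_iff' hm).2 (ae_of_all _ fun x hx => ?_)
    simp only [norm_mul]
    gcongr
    exact (norm_snd_le x.2).trans (hd _ hx.2)

lemma memLp_mul {f : ℝ × ℝ × ℝ → ℝ} (hf : MemLp f 2 (volume.restrict (univ ×ˢ ω)))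
    {c : ℝ → ℝ} (hc : Continuous c) {B : ℝ} (hB : ∀ s, |c s| ≤ B) :
    MemLp (fun x => c x.1 * f x) 2 (volume.restrict (univ ×ˢ ω)) := by
  refine hf.of_le_mul (c := B) ((hc.comp continuous_fst).aestronglyMeasurable.mul
    hf.aestronglyMeasurable) (ae_of_all _ fun x => ?_)
  rw [norm_mul]
  gcongr
  exact hB x.1

lemma memLp_dTwist (hω : IsOpen ω) {d : ℝ} (hd : ∀ t ∈ ω, ‖t‖ ≤ d) {θ : ℝ → ℝ}
    (hθ : Continuous (deriv θ)) {B : ℝ} (hB : ∀ s, |deriv θ s| ≤ B) (h : Admissible ω a l ψ) :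
    MemLp (dTwist θ ψ) 2 (volume.restrict (univ ×ˢ ω)) :=
  (h.memLp_dS hω).add (memLp_mul (h.memLp_dTau hω hd) hθ hB)

lemma contDiffOn_slice (h : Admissible ω a l ψ) (s : ℝ) :
    ContDiffOn ℝ 1 (fun t => ψ (s, t)) (closure ω) :=
  h.1.comp (contDiff_prodMk_right s).contDiffOn fun _ ht => ⟨mem_univ _, ht⟩

lemma slice_eq_zero (h : Admissible ω a l ψ) {s : ℝ} (hs : s ≤ a) :
    ∀ t ∈ frontier ω, ψ (s, t) = 0 :=
  fun t ht => h.2.2.2.2.2 s t ht fun hmem => absurd hmem.1 (not_lt.2 hs)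

/-- The transverse Dirichlet inequality integrated over a longitudinal set to the left of the
window. -/
lemma transverse_poincare (hω : IsOpen ω) (hb : Bornology.IsBounded ω)
    {E : ℝ} (hE : ∀ w, TestFun ω w → E * ∫ t in ω, (w t) ^ 2 ≤ ∫ t in ω, gradVsq w t)
    (h : Admissible ω a l ψ) {A : Set ℝ} (hA : MeasurableSet A) (hAa : ∀ s ∈ A, s ≤ a) :
    E * ∫ x in A ×ˢ ω, (ψ x) ^ 2 ≤ ∫ x in A ×ˢ ω, gradTsq ψ x := by
  have hsub : A ×ˢ ω ⊆ univ ×ˢ ω := prod_mono (subset_univ _) subset_rfl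
  have i0 : Integrable (fun x => (ψ x) ^ 2) ((volume.restrict A).prod (volume.restrict ω)) := by
    rw [← volume_restrict_prod]; exact h.2.1.mono_set hsub
  have ig : Integrable (gradTsq ψ) ((volume.restrict A).prod (volume.restrict ω)) := by
    rw [← volume_restrict_prod]
    exact (h.2.2.2.1.add h.2.2.2.2.1).mono_set hsub
  rw [volume_restrict_prod, integral_prod _ i0, integral_prod _ ig, ← integral_const_mul]
  refine integral_mono_ae (i0.integral_prod_left.const_mul E) ig.integral_prod_left ?_
  filter_upwards [i0.prod_right_ae, ig.prod_right_ae, ae_restrict_mem hA] with s h0 h1 hs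
  exact poincare_of_contDiffOn_closure hω hb hE (h.contDiffOn_slice s)
    (h.slice_eq_zero (hAa s hs)) h0 h1

/-- The angular part of the twisted derivative does not contribute to the Hardy identity. -/
lemma integral_weight_mul_dTau_eq_zero (hω : IsOpen ω) (hb : Bornology.IsBounded ω)
    {d : ℝ} (hd : ∀ t ∈ ω, ‖t‖ ≤ d) (h : Admissible ω a l ψ)
    {A : Set ℝ} (hA : MeasurableSet A) (hAa : ∀ s ∈ A, s ≤ a)
    {c : ℝ → ℝ} (hc : Continuous c) {B : ℝ} (hB : ∀ s, |c s| ≤ B) :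
    ∫ x in A ×ˢ ω, c x.1 * (ψ x * dTau ψ x) = 0 := by
  have hsub : A ×ˢ ω ⊆ univ ×ˢ ω := prod_mono (subset_univ _) subset_rfl
  have i0 : IntegrableOn (fun x => ψ x * dTau ψ x) (univ ×ˢ ω) :=
    (h.memLp hω).integrable_mul (h.memLp_dTau hω hd)
  have i1 : IntegrableOn (fun x => c x.1 * (ψ x * dTau ψ x)) (univ ×ˢ ω) :=
    i0.bdd_mul (hc.comp continuous_fst).aestronglyMeasurable (ae_of_all _ fun x => hB x.1)
  replace i0 := i0.mono_set hsub
  replace i1 := i1.mono_set hsub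
  rw [IntegrableOn, volume_restrict_prod] at i0 i1
  rw [volume_restrict_prod, integral_prod _ i1]
  refine integral_eq_zero_of_ae ?_
  filter_upwards [i0.prod_right_ae, ae_restrict_mem hA] with s h0 hs
  rw [integral_const_mul]
  have := integral_mul_dTauV_eq_zero hω hb (h.contDiffOn_slice s) (h.slice_eq_zero (hAa s hs)) h0
  exact mul_eq_zero_of_right _ this

/-- Longitudinal integration by parts against the Hardy field. -/
lemma integral_hardyField_mul_dS (hω : IsOpen ω) (h : Admissible ω a l ψ)
    {p r : ℝ} (hr : 0 < r) :
    ∫ x in Iio p ×ˢ ω, (2 * (hardyField p r x.1 * (ψ x * dS ψ x))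
      + hardyFieldDeriv p r x.1 * (ψ x) ^ 2) = 0 := by
  have hsub : Iio p ×ˢ ω ⊆ univ ×ˢ ω := prod_mono (subset_univ _) subset_rfl
  have i1 : IntegrableOn (fun x => hardyField p r x.1 * (ψ x * dS ψ x)) (univ ×ˢ ω) :=
    ((h.memLp hω).integrable_mul (h.memLp_dS hω)).bdd_mul
      ((continuous_hardyField hr).comp continuous_fst).aestronglyMeasurable
      (ae_of_all _ fun x => abs_hardyField_le hr x.1)
  have i2 : IntegrableOn (fun x => hardyFieldDeriv p r x.1 * (ψ x) ^ 2) (univ ×ˢ ω) :=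
    h.2.1.bdd_mul ((continuous_hardyFieldDeriv hr).comp continuous_fst).aestronglyMeasurable
      (ae_of_all _ fun x => abs_hardyFieldDeriv_le hr x.1)
  have i3 : IntegrableOn (fun x => hardyField p r x.1 * (ψ x) ^ 2) (univ ×ˢ ω) :=
    h.2.1.bdd_mul ((continuous_hardyField hr).comp continuous_fst).aestronglyMeasurable
      (ae_of_all _ fun x => abs_hardyField_le hr x.1)
  have i4 : IntegrableOn (fun x => 2 * (hardyField p r x.1 * (ψ x * dS ψ x))
      + hardyFieldDeriv p r x.1 * (ψ x) ^ 2) (Iio p ×ˢ ω) :=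
    IntegrableOn.mono_set ((i1.const_mul 2).add i2) hsub
  replace i3 := i3.mono_set hsub
  rw [IntegrableOn, volume_restrict_prod] at i3 i4
  rw [volume_restrict_prod, integral_prod_symm _ i4]
  refine integral_eq_zero_of_ae ?_
  filter_upwards [i3.prod_left_ae, i4.prod_left_ae, ae_restrict_mem hω.measurableSet]
    with t h3 h4 ht
  have hderiv : ∀ s ∈ Iic p, HasDerivAt (fun s => hardyField p r s * (ψ (s, t)) ^ 2)
      (2 * (hardyField p r s * (ψ (s, t) * dS ψ (s, t)))
        + hardyFieldDeriv p r s * (ψ (s, t)) ^ 2) s := by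
    intro s _
    have hd := h.differentiableAt hω (x := (s, t)) ht
    have hψ := hasDerivAt_longitudinal hd
    rw [← dS_eq_fderiv hd] at hψ
    refine ((hasDerivAt_hardyField hr s).mul (hψ.pow 2)).congr_deriv ?_
    simp only [Pi.pow_apply]
    push_cast
    ring
  have h3' : IntegrableOn (fun s => hardyField p r s * (ψ (s, t)) ^ 2) (Iic p) := by
    rw [integrableOn_Iic_iff_integrableOn_Iio]; exact h3
  have h4' : IntegrableOn (fun s => 2 * (hardyField p r s * (ψ (s, t) * dS ψ (s, t)))
      + hardyFieldDeriv p r s * (ψ (s, t)) ^ 2) (Iic p) := by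
    rw [integrableOn_Iic_iff_integrableOn_Iio]; exact h4
  have hlim := tendsto_zero_of_hasDerivAt_of_integrableOn_Iic hderiv h4' h3'
  have := integral_Iic_of_hasDerivAt_of_tendsto' hderiv h4' hlim
  rw [integral_Iic_eq_integral_Iio] at this
  simpa [hardyField] using this

/-- The Hardy inequality for the twisted derivative, with the potential of the Hardy field. -/
lemma integral_hardyField_potential_le (hω : IsOpen ω) (hb : Bornology.IsBounded ω)
    {d : ℝ} (hd : ∀ t ∈ ω, ‖t‖ ≤ d) {θ : ℝ → ℝ} (hθ : Continuous (deriv θ)) {B : ℝ}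
    (hB : ∀ s, |deriv θ s| ≤ B) (h : Admissible ω a l ψ) {p r : ℝ} (hr : 0 < r) (hpa : p ≤ a) :
    ∫ x in Iio p ×ˢ ω, (-hardyFieldDeriv p r x.1 - hardyField p r x.1 ^ 2) * (ψ x) ^ 2
      ≤ ∫ x in Iio p ×ˢ ω, (dTwist θ ψ x) ^ 2 := by
  have hsub : Iio p ×ˢ ω ⊆ univ ×ˢ ω := prod_mono (subset_univ _) subset_rfl
  have hf := continuous_hardyField (p := p) hr
  have mf := memLp_mul (h.memLp hω) hf (abs_hardyField_le hr)
  have mD := h.memLp_dTwist hω hd hθ hB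
  have hcB : ∀ s, |2 * (hardyField p r s * deriv θ s)| ≤ 2 * (1 / (2 * r) * B) := by
    intro s
    rw [abs_mul, abs_mul, abs_two]
    have := abs_hardyField_le (p := p) hr s
    have := hB s
    gcongr
  have hcc : Continuous fun s => 2 * (hardyField p r s * deriv θ s) := by fun_prop
  have iτ : IntegrableOn (fun x => 2 * (hardyField p r x.1 * deriv θ x.1) * (ψ x * dTau ψ x))
      (univ ×ˢ ω) :=
    ((h.memLp hω).integrable_mul (h.memLp_dTau hω hd)).bdd_mul
      (hcc.comp continuous_fst).aestronglyMeasurable (ae_of_all _ fun x => hcB x.1)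
  have iS : IntegrableOn (fun x => 2 * (hardyField p r x.1 * (ψ x * dS ψ x))
      + hardyFieldDeriv p r x.1 * (ψ x) ^ 2) (univ ×ˢ ω) := by
    refine Integrable.add (Integrable.const_mul ?_ 2) ?_
    · exact ((h.memLp hω).integrable_mul (h.memLp_dS hω)).bdd_mul
        (hf.comp continuous_fst).aestronglyMeasurable
        (ae_of_all _ fun x => abs_hardyField_le hr x.1)
    · exact h.2.1.bdd_mul ((continuous_hardyFieldDeriv hr).comp continuous_fst).aestronglyMeasurable
        (ae_of_all _ fun x => abs_hardyFieldDeriv_le hr x.1)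
  have iQ : IntegrableOn (fun x => (dTwist θ ψ x - hardyField p r x.1 * ψ x) ^ 2) (univ ×ˢ ω) :=
    (mD.sub mf).integrable_sq
  have iD : IntegrableOn (fun x => (dTwist θ ψ x) ^ 2) (univ ×ˢ ω) := mD.integrable_sq
  have hτ := h.integral_weight_mul_dTau_eq_zero hω hb hd (measurableSet_Iio (a := p))
    (fun s hs => (le_of_lt hs).trans hpa) hcc hcB
  have hS := h.integral_hardyField_mul_dS hω (p := p) hr
  have hQ : 0 ≤ ∫ x in Iio p ×ˢ ω, (dTwist θ ψ x - hardyField p r x.1 * ψ x) ^ 2 :=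
    integral_nonneg fun x => sq_nonneg _
  have heq : ∀ x, (-hardyFieldDeriv p r x.1 - hardyField p r x.1 ^ 2) * (ψ x) ^ 2
      = (dTwist θ ψ x) ^ 2 - (dTwist θ ψ x - hardyField p r x.1 * ψ x) ^ 2
        - (2 * (hardyField p r x.1 * (ψ x * dS ψ x)) + hardyFieldDeriv p r x.1 * (ψ x) ^ 2)
        - 2 * (hardyField p r x.1 * deriv θ x.1) * (ψ x * dTau ψ x) := by
    intro x
    simp only [dTwist]
    ring
  simp_rw [heq]
  replace iD := iD.mono_set hsub
  replace iQ := iQ.mono_set hsub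
  replace iS := iS.mono_set hsub
  replace iτ := iτ.mono_set hsub
  have iDQ : IntegrableOn (fun x => (dTwist θ ψ x) ^ 2
      - (dTwist θ ψ x - hardyField p r x.1 * ψ x) ^ 2) (Iio p ×ˢ ω) := iD.sub iQ
  have iDQS : IntegrableOn (fun x => (dTwist θ ψ x) ^ 2
      - (dTwist θ ψ x - hardyField p r x.1 * ψ x) ^ 2
      - (2 * (hardyField p r x.1 * (ψ x * dS ψ x)) + hardyFieldDeriv p r x.1 * (ψ x) ^ 2))
      (Iio p ×ˢ ω) := iDQ.sub iS
  rw [integral_sub iDQS iτ, integral_sub iDQ iS, integral_sub iD iQ]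
  linarith

/-- The weighted Hardy inequality with a defect term on `(p - r, p)`. -/
lemma integral_rho_le (hω : IsOpen ω) (hb : Bornology.IsBounded ω)
    {d : ℝ} (hd : ∀ t ∈ ω, ‖t‖ ≤ d) {θ : ℝ → ℝ} (hθ : Continuous (deriv θ)) {B : ℝ}
    (hB : ∀ s, |deriv θ s| ≤ B) (h : Admissible ω a l ψ) {p r : ℝ} (hr : 0 < r) (hpa : p ≤ a) :
    2 / 25 * ∫ x in Iio p ×ˢ ω, rho p x.1 * (ψ x) ^ 2
      ≤ (∫ x in Iio p ×ˢ ω, (dTwist θ ψ x) ^ 2)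
        + (2 / r ^ 2 + 2 / 25) * ∫ x in Ioo (p - r) p ×ˢ ω, (ψ x) ^ 2 := by
  have hsub : Iio p ×ˢ ω ⊆ univ ×ˢ ω := prod_mono (subset_univ _) subset_rfl
  have hsub' : Ioo (p - r) p ×ˢ ω ⊆ Iio p ×ˢ ω := prod_mono (fun s hs => hs.2) subset_rfl
  have hmI : MeasurableSet (Ioo (p - r) p ×ˢ ω) := measurableSet_Ioo.prod hω.measurableSet
  have hmP : MeasurableSet (Iio p ×ˢ ω) := measurableSet_Iio.prod hω.measurableSet
  have i0 : IntegrableOn (fun x => (ψ x) ^ 2) (Iio p ×ˢ ω) := h.2.1.mono_set hsub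
  have iρ : IntegrableOn (fun x => rho p x.1 * (ψ x) ^ 2) (Iio p ×ˢ ω) :=
    i0.bdd_mul (c := 1) (measurable_rho.comp measurable_fst).aestronglyMeasurable
      (ae_of_all _ fun x => by
        rw [Real.norm_eq_abs, abs_of_nonneg (rho_nonneg x.1)]; exact rho_le_one x.1)
  have hf := continuous_hardyField (p := p) hr
  have hf' := continuous_hardyFieldDeriv (p := p) hr
  have iV : IntegrableOn (fun x => (-hardyFieldDeriv p r x.1 - hardyField p r x.1 ^ 2) * (ψ x) ^ 2)
      (Iio p ×ˢ ω) := by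
    have hc : Continuous fun s => -hardyFieldDeriv p r s - hardyField p r s ^ 2 := by fun_prop
    refine i0.bdd_mul (c := 2 / r ^ 2 + (1 / (2 * r)) ^ 2)
      (hc.comp continuous_fst).aestronglyMeasurable (ae_of_all _ fun x => ?_)
    refine (norm_sub_le _ _).trans ?_
    rw [norm_neg, norm_pow]
    exact add_le_add (abs_hardyFieldDeriv_le hr x.1)
      (pow_le_pow_left₀ (norm_nonneg _) (abs_hardyField_le hr x.1) 2)
  have iI : IntegrableOn ((Ioo (p - r) p ×ˢ ω).indicator fun x => (ψ x) ^ 2) (Iio p ×ˢ ω) :=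
    i0.indicator hmI
  have hmain : ∫ x in Iio p ×ˢ ω, 2 / 25 * (rho p x.1 * (ψ x) ^ 2)
      ≤ ∫ x in Iio p ×ˢ ω, ((-hardyFieldDeriv p r x.1 - hardyField p r x.1 ^ 2) * (ψ x) ^ 2
        + (2 / r ^ 2 + 2 / 25) * (Ioo (p - r) p ×ˢ ω).indicator (fun x => (ψ x) ^ 2) x) := by
    refine setIntegral_mono_on (iρ.const_mul _) (iV.add (iI.const_mul _)) hmP fun x hx => ?_
    by_cases hxI : x ∈ Ioo (p - r) p ×ˢ ω
    · rw [indicator_of_mem hxI]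
      have h1 := rho_le_one (p := p) x.1
      have h2 := neg_le_hardyField_potential (p := p) hr x.1
      nlinarith [mul_le_mul_of_nonneg_right h1 (sq_nonneg (ψ x)),
        mul_le_mul_of_nonneg_right h2 (sq_nonneg (ψ x))]
    · rw [indicator_of_notMem hxI]
      have hxs : x.1 ≤ p - r := by
        by_contra hlt
        exact hxI ⟨⟨not_le.1 hlt, hx.1⟩, hx.2⟩
      have h1 := rho_le_hardyField_potential hr hxs
      nlinarith [mul_le_mul_of_nonneg_right h1 (sq_nonneg (ψ x))]
  rw [integral_const_mul, integral_add iV (iI.const_mul _), integral_const_mul,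
    setIntegral_indicator hmI, inter_eq_self_of_subset_right hsub'] at hmain
  have := h.integral_hardyField_potential_le hω hb hd hθ hB hr hpa
  linarith

end Admissible

lemma mul_integral_sq_le_of_eq_sInf {ω : Set (ℝ × ℝ)} {E : ℝ}
    (hE : E = sInf {r : ℝ | ∃ v : ℝ × ℝ → ℝ, TestFun ω v ∧ v ≠ 0 ∧
      r = (∫ t in ω, gradVsq v t) / ∫ t in ω, (v t) ^ 2}) {w : ℝ × ℝ → ℝ} (hw : TestFun ω w) :
    E * ∫ t in ω, (w t) ^ 2 ≤ ∫ t in ω, gradVsq w t := by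
  have hg : ∀ v : ℝ × ℝ → ℝ, 0 ≤ ∫ t in ω, gradVsq v t := fun v =>
    integral_nonneg fun t => add_nonneg (sq_nonneg _) (sq_nonneg _)
  have hs : ∀ v : ℝ × ℝ → ℝ, 0 ≤ ∫ t in ω, (v t) ^ 2 := fun v =>
    integral_nonneg fun t => sq_nonneg _
  rcases (hs w).eq_or_lt with h0 | hpos
  · rw [← h0, mul_zero]; exact hg w
  · have hw0 : w ≠ 0 := by
      rintro rfl
      simp at hpos
    rw [← le_div_iff₀ hpos, hE]
    refine csInf_le ⟨0, ?_⟩ ⟨w, hw, hw0, rfl⟩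
    rintro _ ⟨v, -, -, rfl⟩
    exact div_nonneg (hg v) (hs v)

theorem stmt_8 (ω : Set (ℝ × ℝ)) (hω_open : IsOpen ω) (hω_bdd : Bornology.IsBounded ω)
    (hω_conn : IsConnected ω)
    (d : ℝ) (hd : ∀ t ∈ ω, ‖t‖ ≤ d)
    (E₁ : ℝ)
    (hE₁ : E₁ = sInf {r : ℝ | ∃ v : ℝ × ℝ → ℝ, TestFun ω v ∧ v ≠ 0 ∧
      r = (∫ t in ω, gradVsq v t) / ∫ t in ω, (v t) ^ 2})
    (θ : ℝ → ℝ) (hθ : ContDiff ℝ 1 θ) (hθc : HasCompactSupport θ)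
    (hθ'' : Differentiable ℝ (deriv θ)) (M : ℝ) (hM : ∀ s, |deriv (deriv θ) s| ≤ M)
    (θm θM : ℝ) (hθm : θm = sInf (tsupport (deriv θ))) (hθM : θM = sSup (tsupport (deriv θ)))
    (a l : ℝ) (ha : θM ≤ a) (hl : 0 < l)
    (p r : ℝ) (hp : p ∈ Set.Ioo θm θM) (hr : 0 < r)
    (hθ'ne : ∀ s ∈ Set.Icc (p - r) p, deriv θ s ≠ 0)
    -- (i) spectral gap of the cross-section with the angular derivative
    (lam : ℝ) (hlam : 0 < lam)
    (hGap : ∀ v : ℝ × ℝ → ℝ, TestFun ω v →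
      (∫ t in ω, (dTauV v t) ^ 2) + (∫ t in ω, gradVsq v t) - E₁ * (∫ t in ω, (v t) ^ 2)
        ≥ lam * ∫ t in ω, (v t) ^ 2)
    -- (ii) lower bound for the localized form on `(p-r, p)`
    (lam₀ : ℝ) (hlam₀ : 0 < lam₀)
    (hQ : ∀ ψ : ℝ × ℝ × ℝ → ℝ, Admissible ω a l ψ →
      Qform ω E₁ θ (Set.Ioo (p - r) p) ψ
        ≥ lam₀ * ∫ x in Set.Ioo (p - r) p ×ˢ ω, (ψ x) ^ 2) :
    ∃ C > 0, ∀ ψ : ℝ × ℝ × ℝ → ℝ, Admissible ω a l ψ →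
      (∫ x in Set.Iio p ×ˢ ω,
          (gradTsq ψ x + (dS ψ x + deriv θ x.1 * dTau ψ x) ^ 2 - E₁ * (ψ x) ^ 2))
        ≥ C * ∫ x in Set.Iio p ×ˢ ω, rho p x.1 * (ψ x) ^ 2 := by
  have hE : ∀ w, TestFun ω w → E₁ * ∫ t in ω, (w t) ^ 2 ≤ ∫ t in ω, gradVsq w t :=
    fun w hw => mul_integral_sq_le_of_eq_sInf hE₁ hw
  have hθ' : Continuous (deriv θ) := hθ''.continuous
  obtain ⟨B, hB⟩ := hθc.deriv.exists_bound_of_continuous hθ'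
  have hpa : p ≤ a := hp.2.le.trans ha
  set b : ℝ := 2 / r ^ 2 + 2 / 25 with hb
  have hb0 : 0 < b := by positivity
  have hden : 0 < 1 + b / lam₀ := by positivity
  refine ⟨2 / 25 / (1 + b / lam₀), by positivity, fun ψ h => ?_⟩
  have hρ := h.integral_rho_le hω_open hω_bdd hd hθ' hB hr hpa
  have hI := hQ ψ h
  have hPsub : Iio p ×ˢ ω ⊆ univ ×ˢ ω := prod_mono (subset_univ _) subset_rfl
  have i0 : IntegrableOn (fun x => (ψ x) ^ 2) (Iio p ×ˢ ω) := h.2.1.mono_set hPsub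
  have ig : IntegrableOn (gradTsq ψ) (Iio p ×ˢ ω) :=
    IntegrableOn.mono_set (h.2.2.2.1.add h.2.2.2.2.1) hPsub
  have iD : IntegrableOn (fun x => (dTwist θ ψ x) ^ 2) (Iio p ×ˢ ω) :=
    IntegrableOn.mono_set (h.memLp_dTwist hω_open hd hθ' hB).integrable_sq hPsub
  have hunion : Iio p ×ˢ ω = Iic (p - r) ×ˢ ω ∪ Ioo (p - r) p ×ˢ ω := by
    rw [← union_prod, Iic_union_Ioo_eq_Iio (by linarith)]
  have hdisj : Disjoint (Iic (p - r) ×ˢ ω) (Ioo (p - r) p ×ˢ ω) :=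
    disjoint_prod.2 (Or.inl (disjoint_left.2 fun s hs hs' => not_lt.2 hs hs'.1))
  have hmI : MeasurableSet (Ioo (p - r) p ×ˢ ω) := measurableSet_Ioo.prod hω_open.measurableSet
  have split : ∀ f : ℝ × ℝ × ℝ → ℝ, IntegrableOn f (Iio p ×ˢ ω) →
      ∫ x in Iio p ×ˢ ω, f x
        = (∫ x in Iic (p - r) ×ˢ ω, f x) + ∫ x in Ioo (p - r) p ×ˢ ω, f x := by
    intro f hf
    rw [hunion] at hf ⊢
    exact setIntegral_union hdisj hmI (hf.mono_set subset_union_left)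
      (hf.mono_set subset_union_right)
  have s0 := split _ i0
  have sg := split _ ig
  have sD := split _ iD
  have hP := h.transverse_poincare hω_open hω_bdd hE (measurableSet_Iio (a := p))
    fun s hs => (le_of_lt hs).trans hpa
  have hL := h.transverse_poincare hω_open hω_bdd hE (measurableSet_Iic (a := p - r))
    fun s hs => le_trans (mem_Iic.1 hs) (by linarith)
  have hDL : 0 ≤ ∫ x in Iic (p - r) ×ˢ ω, (dTwist θ ψ x) ^ 2 :=
    integral_nonneg fun x => sq_nonneg _
  have hLHS : ∫ x in Iio p ×ˢ ω,
      (gradTsq ψ x + (dS ψ x + deriv θ x.1 * dTau ψ x) ^ 2 - E₁ * (ψ x) ^ 2)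
      = (∫ x in Iio p ×ˢ ω, gradTsq ψ x) + (∫ x in Iio p ×ˢ ω, (dTwist θ ψ x) ^ 2)
        - E₁ * ∫ x in Iio p ×ˢ ω, (ψ x) ^ 2 := by
    have igD : IntegrableOn (fun x => gradTsq ψ x + (dTwist θ ψ x) ^ 2) (Iio p ×ˢ ω) := ig.add iD
    rw [← integral_const_mul, ← integral_add ig iD, ← integral_sub igD (i0.const_mul E₁)]
    rfl
  have hI' : lam₀ * ∫ x in Ioo (p - r) p ×ˢ ω, (ψ x) ^ 2
      ≤ (∫ x in Ioo (p - r) p ×ˢ ω, gradTsq ψ x)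
        - E₁ * (∫ x in Ioo (p - r) p ×ˢ ω, (ψ x) ^ 2)
        + ∫ x in Ioo (p - r) p ×ˢ ω, (dTwist θ ψ x) ^ 2 := hI
  rw [hLHS, ge_iff_le, div_mul_eq_mul_div, div_le_iff₀ hden]
  set Q : ℝ := (∫ x in Iio p ×ˢ ω, gradTsq ψ x) + (∫ x in Iio p ×ˢ ω, (dTwist θ ψ x) ^ 2)
    - E₁ * ∫ x in Iio p ×ˢ ω, (ψ x) ^ 2 with hQdef
  have hQI : lam₀ * ∫ x in Ioo (p - r) p ×ˢ ω, (ψ x) ^ 2 ≤ Q := by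
    rw [hQdef, s0, sg, sD]
    linarith
  have hN : b * ∫ x in Ioo (p - r) p ×ˢ ω, (ψ x) ^ 2 ≤ b / lam₀ * Q := by
    rw [div_mul_eq_mul_div, le_div_iff₀ hlam₀]
    nlinarith [mul_le_mul_of_nonneg_left hQI hb0.le]
  have hDQ : ∫ x in Iio p ×ˢ ω, (dTwist θ ψ x) ^ 2 ≤ Q := by
    rw [hQdef]; linarith
  calc 2 / 25 * ∫ x in Iio p ×ˢ ω, rho p x.1 * (ψ x) ^ 2
      ≤ (∫ x in Iio p ×ˢ ω, (dTwist θ ψ x) ^ 2)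
        + b * ∫ x in Ioo (p - r) p ×ˢ ω, (ψ x) ^ 2 := hρ
    _ ≤ Q + b / lam₀ * Q := add_le_add hDQ hN
    _ = Q * (1 + b / lam₀) := by ring
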